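/- Connection between vanishing at infinity and Rajchman measures, on ℝ: let μ₊, μ₋ be translation bounded positive regular Borel measures on ℝ and write μ∗g := μ₊∗g − μ₋∗g. Let ν₁, ν₂, ν₃, ν₄ be positive regular Borel measures on ℝ and write ∫F dμ̂ := ∫F dν₁ − ∫F dν₂ + i(∫F dν₃ − ∫F dν₄). Assume μ is Fourier transformable with transform μ̂: for every f ∈ C_c(ℝ), |f̌|² is integrable with respect to each ν_j (j = 1,2,3,4) and ∫_ℝ (f∗f̃) dμ₊ − ∫_ℝ (f∗f̃) dμ₋ = ∫_ℝ |f̌(ξ)|² dμ̂(ξ). Then the following are equivalent: (a) μ vanishes at infinity, i.e. μ∗g ∈ C₀(ℝ) for every g ∈ C_c(ℝ); (b) for every f ∈ C_c(ℝ), the finite measure |f̌|²·μ̂ is a Rajchman measure, i.e. the function t ↦ ∫_ℝ |f̌(ξ)|² e^{2πitξ} dμ̂(ξ) belongs to C₀(ℝ). -/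

import Mathlib

open MeasureTheory Filter Topology Real
open scoped NNReal

noncomputable def EE (f : ℝ → ℂ) (ξ : ℝ) : ℂ := ∫ x : ℝ, f x * Complex.exp (2 * π * Complex.I * ξ * x)
noncomputable def SS (f g : ℝ → ℂ) (x : ℝ) : ℂ := ∫ t : ℝ, f (x - t) * (starRingEnd ℂ) (g (-t))

lemma lin4 {ν : Measure ℝ} {a b c d : ℝ → ℂ} (ha : Integrable a ν) (hb : Integrable b ν)
    (hc : Integrable c ν) (hd : Integrable d ν) (α β γ δ : ℂ) :
    ∫ x, (α * a x + β * b x + γ * c x + δ * d x) ∂ν =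
      α * (∫ x, a x ∂ν) + β * (∫ x, b x ∂ν) + γ * (∫ x, c x ∂ν) + δ * ∫ x, d x ∂ν := by
  have h1 := ha.const_mul α
  have h2 := hb.const_mul β
  have h3 := hc.const_mul γ
  have h4 := hd.const_mul δ
  have h12 : Integrable (fun x => α * a x + β * b x) ν := h1.add h2
  have h123 : Integrable (fun x => α * a x + β * b x + γ * c x) ν := h12.add h3
  rw [integral_add h123 h4, integral_add h12 h3, integral_add h1 h2, integral_const_mul,
    integral_const_mul, integral_const_mul, integral_const_mul]

lemma EE_int {f : ℝ → ℂ} (hf : Continuous f) (hc : HasCompactSupport f) (ξ : ℝ) :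
    Integrable (fun x : ℝ => f x * Complex.exp (2 * π * Complex.I * ξ * x)) :=
  Continuous.integrable_of_hasCompactSupport (by fun_prop) hc.mul_right

lemma EE_lin {f g : ℝ → ℂ} (hf : Continuous f) (hc : HasCompactSupport f)
    (hg : Continuous g) (hd : HasCompactSupport g) (c : ℂ) (ξ : ℝ) :
    EE (fun x => f x + c * g x) ξ = EE f ξ + c * EE g ξ := by
  unfold EE
  rw [← integral_const_mul, ← integral_add (EE_int hf hc ξ) ((EE_int hg hd ξ).const_mul c)]
  congr 1; ext x; ring

lemma EE_trans (f : ℝ → ℂ) (s ξ : ℝ) :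
    EE (fun x => f (x - s)) ξ = Complex.exp (2 * π * Complex.I * s * ξ) * EE f ξ := by
  unfold EE
  rw [← integral_const_mul, ← integral_sub_right_eq_self
    (fun x : ℝ => Complex.exp (2 * π * Complex.I * s * ξ) * (f x * Complex.exp (2 * π * Complex.I * ξ * x))) s]
  congr 1; ext x
  rw [mul_left_comm, ← Complex.exp_add]
  congr 2; push_cast; ring

lemma star_cs {g : ℝ → ℂ} (hd : HasCompactSupport g) :
    HasCompactSupport (fun t => (starRingEnd ℂ) (g (-t))) := by
  have h1 : HasCompactSupport (fun t => g (-t)) := hd.comp_homeomorph (Homeomorph.neg ℝ)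
  exact h1.comp_left (g := starRingEnd ℂ) (map_zero _)

lemma SS_int {f g : ℝ → ℂ} (hf : Continuous f)
    (hg : Continuous g) (hd : HasCompactSupport g) (x : ℝ) :
    Integrable (fun t : ℝ => f (x - t) * (starRingEnd ℂ) (g (-t))) :=
  Continuous.integrable_of_hasCompactSupport (by fun_prop) (star_cs hd).mul_left

lemma SS_eq (f g : ℝ → ℂ) :
    SS f g = convolution (fun t => (starRingEnd ℂ) (g (-t))) f (ContinuousLinearMap.mul ℝ ℂ) volume := by
  ext x
  simp [SS, convolution, mul_comm]

lemma SS_cont {f g : ℝ → ℂ} (hf : Continuous f) (hc : HasCompactSupport f)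
    (hg : Continuous g) : Continuous (SS f g) := by
  rw [SS_eq]
  refine hc.continuous_convolution_right _ ?_ hf
  exact Continuous.locallyIntegrable (by fun_prop)

lemma SS_cs {f g : ℝ → ℂ} (hc : HasCompactSupport f)
    (hd : HasCompactSupport g) : HasCompactSupport (SS f g) := by
  rw [SS_eq]
  exact HasCompactSupport.convolution _ (star_cs hd) hc

lemma SS_trans (f g : ℝ → ℂ) (s x : ℝ) : SS (fun x => f (x - s)) g x = SS f g (x - s) := by
  unfold SS
  congr 1; ext t
  rw [sub_right_comm]

lemma add_cont {f g : ℝ → ℂ} (hf : Continuous f) (hg : Continuous g) (c : ℂ) :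
    Continuous (fun x => f x + c * g x) := by fun_prop

lemma add_cs {f g : ℝ → ℂ} (hc : HasCompactSupport f) (hd : HasCompactSupport g) (c : ℂ) :
    HasCompactSupport (fun x => f x + c * g x) := hc.add hd.mul_left

lemma trans_cs {f : ℝ → ℂ} (hc : HasCompactSupport f) (s : ℝ) :
    HasCompactSupport (fun x => f (x - s)) :=
  hc.comp_homeomorph (Homeomorph.subRight s)

lemma SS_diag {f g : ℝ → ℂ} (hf : Continuous f) (hc : HasCompactSupport f)
    (hg : Continuous g) (hd : HasCompactSupport g) (c : ℂ) (x : ℝ) :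
    SS (fun x => f x + c * g x) (fun x => f x + c * g x) x =
      SS f f x + c * SS g f x + (starRingEnd ℂ) c * SS f g x
        + c * (starRingEnd ℂ) c * SS g g x := by
  unfold SS
  have := lin4 (SS_int hf hf hc x) (SS_int hg hf hc x) (SS_int hf hg hd x) (SS_int hg hg hd x)
    1 c ((starRingEnd ℂ) c) (c * (starRingEnd ℂ) c)
  rw [one_mul] at this
  rw [← this]
  congr 1; ext t
  simp only [map_add, map_mul]
  ring

lemma SS_polar {f g : ℝ → ℂ} (hf : Continuous f) (hc : HasCompactSupport f)
    (hg : Continuous g) (hd : HasCompactSupport g) (x : ℝ) :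
    SS f g x = (1/4) * SS (fun x => f x + 1 * g x) (fun x => f x + 1 * g x) x
      + (-1/4) * SS (fun x => f x + (-1) * g x) (fun x => f x + (-1) * g x) x
      + (Complex.I/4) * SS (fun x => f x + Complex.I * g x) (fun x => f x + Complex.I * g x) x
      + (-Complex.I/4) * SS (fun x => f x + (-Complex.I) * g x) (fun x => f x + (-Complex.I) * g x) x := by
  rw [SS_diag hf hc hg hd, SS_diag hf hc hg hd, SS_diag hf hc hg hd, SS_diag hf hc hg hd]
  simp only [map_one, map_neg, Complex.conj_I]
  have := Complex.I_sq
  linear_combination (SS f g x / 2 - SS g f x / 2) * this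

lemma sq_polar (a b : ℂ) :
    a * (starRingEnd ℂ) b = (1/4) * Complex.ofReal (‖a + 1 * b‖^2) + (-1/4) * Complex.ofReal (‖a + (-1) * b‖^2)
      + (Complex.I/4) * Complex.ofReal (‖a + Complex.I * b‖^2)
      + (-Complex.I/4) * Complex.ofReal (‖a + (-Complex.I) * b‖^2) := by
  simp only [Complex.ofReal_pow, ← Complex.mul_conj', map_add, map_mul, map_one, map_neg, Complex.conj_I]
  have := Complex.I_sq
  linear_combination ((starRingEnd ℂ) b * a / 2 - (starRingEnd ℂ) a * b / 2) * this

lemma tb_bound {μ : Measure ℝ} {C : ℝ≥0} (h : ∀ x : ℝ, μ (Set.Icc x (x + 1)) ≤ C) (n : ℕ) (x : ℝ) :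
    μ (Set.Icc x (x + n)) ≤ ((n + 1) * C : ℝ≥0) := by
  induction n with
  | zero =>
    refine (measure_mono (Set.Icc_subset_Icc_right ?_)).trans ((h x).trans ?_) <;> simp
  | succ n ih =>
    have : Set.Icc x (x + (n+1 : ℕ)) ⊆ Set.Icc x (x + n) ∪ Set.Icc (x + n) (x + n + 1) := by
      intro y hy
      rcases le_total y (x + n) with h | h
      · exact Or.inl ⟨hy.1, h⟩
      · exact Or.inr ⟨h, by have := hy.2; push_cast at this; linarith⟩
    refine (measure_mono this).trans ((measure_union_le _ _).trans ((add_le_add ih (h _)).trans ?_))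
    rw [← ENNReal.coe_add]
    apply le_of_eq
    congr 1; push_cast; ring

lemma conv_bound {μ : Measure ℝ} {C : ℝ≥0} (h : ∀ x : ℝ, μ (Set.Icc x (x + 1)) ≤ C) (n : ℕ)
    {k : ℝ → ℂ} {ε : ℝ} (hk : ∀ x, ‖k x‖ ≤ ε) (hs : ∀ x, (n:ℝ) < |x| → k x = 0) (s : ℝ) :
    ‖∫ x, k (x - s) ∂μ‖ ≤ ε * ((2 * n + 1) * C) := by
  have hb := tb_bound h (2 * n) (s - n)
  have h0 : ∫ x, k (x - s) ∂μ = ∫ x in Set.Icc (s - n) (s - n + (2 * n : ℕ)), k (x - s) ∂μ := by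
    symm
    apply setIntegral_eq_integral_of_forall_compl_eq_zero
    intro x hx
    apply hs
    by_contra hh
    rw [not_lt, abs_le] at hh
    apply hx
    constructor
    · linarith
    · push_cast; linarith
  have hε : 0 ≤ ε := (norm_nonneg _).trans (hk 0)
  rw [h0]
  refine (norm_setIntegral_le_of_norm_le_const (hb.trans_lt ENNReal.coe_lt_top) (fun x _ => hk _)).trans ?_
  gcongr
  rw [Measure.real]
  refine (ENNReal.toReal_mono ENNReal.coe_ne_top hb).trans (le_of_eq ?_)
  push_cast; rfl

lemma approx {g : ℝ → ℂ} (hg : Continuous g) (hc : HasCompactSupport g) {ε : ℝ} (hε : 0 < ε) :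
    ∃ v : ℝ → ℂ, Continuous v ∧ HasCompactSupport v ∧ (∀ x, 1 < |x| → v x = 0) ∧
      ∀ x, ‖SS g v x - g x‖ ≤ ε := by
  obtain ⟨δ, hδ, H⟩ := Metric.uniformContinuous_iff.1 (hc.uniformContinuous_of_continuous hg) ε hε
  let φ : ContDiffBump (0:ℝ) := ⟨min δ 1 / 2, min δ 1, by positivity, half_lt_self (by positivity)⟩
  refine ⟨fun x => ((φ.normed volume x : ℝ) : ℂ), ?_, ?_, ?_, ?_⟩
  · exact Complex.continuous_ofReal.comp φ.continuous_normed
  · exact φ.hasCompactSupport_normed.comp_left (g := Complex.ofReal) Complex.ofReal_zero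
  · intro x hx
    have : x ∉ Function.support (φ.normed volume) := by
      rw [φ.support_normed_eq]
      simp only [Metric.mem_ball, dist_zero_right, Real.norm_eq_abs, not_lt]
      exact (min_le_right _ _).trans hx.le
    simpa using this
  · intro x
    have := φ.dist_normed_convolution_le (μ := volume) (g := g) (x₀ := x) (ε := ε)
      hg.aestronglyMeasurable (fun y hy => (H (lt_of_lt_of_le hy (min_le_left _ _))).le)
    rw [dist_eq_norm] at this
    refine le_of_eq_of_le ?_ this
    congr 2
    unfold SS convolution
    congr 1; ext t
    simp [φ.normed_neg, mul_comm]

lemma SS_supp {f g : ℝ → ℂ} {n : ℝ} (hf : ∀ x, n < |x| → f x = 0) (hg : ∀ x, 1 < |x| → g x = 0)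
    (x : ℝ) (hx : n + 1 < |x|) : SS f g x = 0 := by
  unfold SS
  rw [← integral_zero ℝ ℂ (μ := volume)]
  congr 1; ext t
  by_cases h : 1 < |t|
  · rw [hg (-t) (by rwa [abs_neg])]; simp
  · rw [hf (x - t)]
    · simp
    · have := abs_sub_abs_le_abs_sub x t
      linarith

lemma ct_int {μ : Measure ℝ} [IsFiniteMeasureOnCompacts μ] {h : ℝ → ℂ} (hh : Continuous h)
    (hc : HasCompactSupport h) (s : ℝ) : Integrable (fun x => h (x - s)) μ :=
  Continuous.integrable_of_hasCompactSupport (by fun_prop) (trans_cs hc s)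

lemma ct_cont {μ : Measure ℝ} [IsLocallyFiniteMeasure μ] {g : ℝ → ℂ} (hg : Continuous g)
    (hc : HasCompactSupport g) : Continuous (fun x => ∫ t, g (x - t) ∂μ) := by
  have := hc.continuous_convolution_right (μ := μ) (f := fun _ : ℝ => (1:ℂ))
    (ContinuousLinearMap.mul ℝ ℂ) (locallyIntegrable_const _) hg
  refine this.congr fun x => ?_
  simp [convolution]

/-- the four-term polarised integral identity for the transform side -/
lemma nu_polar {ν : Measure ℝ} (hi : ∀ f : ℝ → ℂ, Continuous f → HasCompactSupport f →
      Integrable (fun ξ : ℝ => ‖EE f ξ‖ ^ 2) ν) {f : ℝ → ℂ} (hf : Continuous f)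
    (hc : HasCompactSupport f) (s : ℝ) :
    ∫ ξ, Complex.ofReal (‖EE f ξ‖ ^ 2) * Complex.exp (2 * π * Complex.I * s * ξ) ∂ν =
      (1/4) * (∫ ξ, Complex.ofReal (‖EE (fun x => f (x - s) + 1 * f x) ξ‖ ^ 2) ∂ν)
      + (-1/4) * (∫ ξ, Complex.ofReal (‖EE (fun x => f (x - s) + (-1) * f x) ξ‖ ^ 2) ∂ν)
      + (Complex.I/4) * (∫ ξ, Complex.ofReal (‖EE (fun x => f (x - s) + Complex.I * f x) ξ‖ ^ 2) ∂ν)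
      + (-Complex.I/4) * ∫ ξ, Complex.ofReal (‖EE (fun x => f (x - s) + (-Complex.I) * f x) ξ‖ ^ 2) ∂ν := by
  have hf' : Continuous (fun x => f (x - s)) := by fun_prop
  have hc' := trans_cs hc s
  have hI : ∀ c : ℂ, Integrable (fun ξ => Complex.ofReal (‖EE (fun x => f (x - s) + c * f x) ξ‖ ^ 2)) ν :=
    fun c => (hi _ (add_cont hf' hf c) (add_cs hc' hc c)).ofReal
  rw [← lin4 (hI 1) (hI (-1)) (hI Complex.I) (hI (-Complex.I))]
  congr 1; ext ξ
  rw [EE_lin hf' hc' hf hc, EE_lin hf' hc' hf hc, EE_lin hf' hc' hf hc, EE_lin hf' hc' hf hc,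
    ← sq_polar, EE_trans, mul_assoc (Complex.exp _), Complex.mul_conj', mul_comm]
  push_cast; rfl

lemma mu_polar {μ : Measure ℝ} [IsFiniteMeasureOnCompacts μ] {f g : ℝ → ℂ} (hf : Continuous f)
    (hc : HasCompactSupport f) (hg : Continuous g) (hd : HasCompactSupport g) (s : ℝ) :
    ∫ x, SS f g (x - s) ∂μ =
      (1/4) * (∫ x, SS (fun x => f x + 1 * g x) (fun x => f x + 1 * g x) (x - s) ∂μ)
      + (-1/4) * (∫ x, SS (fun x => f x + (-1) * g x) (fun x => f x + (-1) * g x) (x - s) ∂μ)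
      + (Complex.I/4) * (∫ x, SS (fun x => f x + Complex.I * g x) (fun x => f x + Complex.I * g x) (x - s) ∂μ)
      + (-Complex.I/4) * ∫ x, SS (fun x => f x + (-Complex.I) * g x) (fun x => f x + (-Complex.I) * g x) (x - s) ∂μ := by
  have hI : ∀ c : ℂ, Integrable (fun x => SS (fun x => f x + c * g x) (fun x => f x + c * g x) (x - s)) μ :=
    fun c => ct_int (SS_cont (add_cont hf hg c) (add_cs hc hd c) (add_cont hf hg c))
      (SS_cs (add_cs hc hd c) (add_cs hc hd c)) s
  rw [← lin4 (hI 1) (hI (-1)) (hI Complex.I) (hI (-Complex.I))]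
  congr 1; ext x
  rw [SS_polar hf hc hg hd]

lemma key (μp μm : Measure ℝ) [μp.Regular] [μm.Regular] (ν₁ ν₂ ν₃ ν₄ : Measure ℝ)
    (hint : ∀ f : ℝ → ℂ, Continuous f → HasCompactSupport f →
      Integrable (fun ξ : ℝ => ‖EE f ξ‖ ^ 2) ν₁ ∧ Integrable (fun ξ : ℝ => ‖EE f ξ‖ ^ 2) ν₂ ∧
      Integrable (fun ξ : ℝ => ‖EE f ξ‖ ^ 2) ν₃ ∧ Integrable (fun ξ : ℝ => ‖EE f ξ‖ ^ 2) ν₄)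
    (hFT : ∀ f : ℝ → ℂ, Continuous f → HasCompactSupport f →
      (∫ x : ℝ, SS f f x ∂μp) - (∫ x : ℝ, SS f f x ∂μm)
        = ((∫ ξ : ℝ, Complex.ofReal (‖EE f ξ‖ ^ 2) ∂ν₁)
            - ∫ ξ : ℝ, Complex.ofReal (‖EE f ξ‖ ^ 2) ∂ν₂)
          + Complex.I * ((∫ ξ : ℝ, Complex.ofReal (‖EE f ξ‖ ^ 2) ∂ν₃)
              - ∫ ξ : ℝ, Complex.ofReal (‖EE f ξ‖ ^ 2) ∂ν₄))
    {f : ℝ → ℂ} (hf : Continuous f) (hc : HasCompactSupport f) (s : ℝ) :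
    (∫ x : ℝ, SS f f (x - s) ∂μp) - (∫ x : ℝ, SS f f (x - s) ∂μm)
        = ((∫ ξ : ℝ, Complex.ofReal (‖EE f ξ‖ ^ 2) * Complex.exp (2 * π * Complex.I * s * ξ) ∂ν₁)
            - ∫ ξ : ℝ, Complex.ofReal (‖EE f ξ‖ ^ 2) * Complex.exp (2 * π * Complex.I * s * ξ) ∂ν₂)
          + Complex.I * ((∫ ξ : ℝ, Complex.ofReal (‖EE f ξ‖ ^ 2) * Complex.exp (2 * π * Complex.I * s * ξ) ∂ν₃)
              - ∫ ξ : ℝ, Complex.ofReal (‖EE f ξ‖ ^ 2) * Complex.exp (2 * π * Complex.I * s * ξ) ∂ν₄) := by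
  have hf' : Continuous (fun x => f (x - s)) := by fun_prop
  have hc' := trans_cs hc s
  rw [nu_polar (fun f h h' => (hint f h h').1) hf hc, nu_polar (fun f h h' => (hint f h h').2.1) hf hc,
    nu_polar (fun f h h' => (hint f h h').2.2.1) hf hc, nu_polar (fun f h h' => (hint f h h').2.2.2) hf hc]
  have e : ∀ μ : Measure ℝ, ∫ x : ℝ, SS f f (x - s) ∂μ =
      ∫ x : ℝ, SS (fun x => f (x - s)) f (x - 0) ∂μ := by
    intro μ; simp only [sub_zero, SS_trans]
  rw [e, e, mu_polar hf' hc' hf hc, mu_polar hf' hc' hf hc]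
  simp only [sub_zero]
  have H := fun c => hFT _ (add_cont hf' hf c) (add_cs hc' hc c)
  linear_combination (1/4) * H 1 + (-1/4) * H (-1) + (Complex.I/4) * H Complex.I
    + (-Complex.I/4) * H (-Complex.I)

lemma dense_part (μp μm : Measure ℝ) [μp.Regular] [μm.Regular]
    (htbp : ∃ C : ℝ≥0, ∀ x : ℝ, μp (Set.Icc x (x + 1)) ≤ C)
    (htbm : ∃ C : ℝ≥0, ∀ x : ℝ, μm (Set.Icc x (x + 1)) ≤ C)
    (hb : ∀ f : ℝ → ℂ, Continuous f → HasCompactSupport f →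
      Tendsto (fun s : ℝ => (∫ x : ℝ, SS f f (x - s) ∂μp) - (∫ x : ℝ, SS f f (x - s) ∂μm))
        (cocompact ℝ) (𝓝 0))
    {h : ℝ → ℂ} (hh : Continuous h) (hc : HasCompactSupport h) :
    Tendsto (fun s : ℝ => (∫ x : ℝ, h (x - s) ∂μp) - (∫ x : ℝ, h (x - s) ∂μm))
        (cocompact ℝ) (𝓝 0) := by
  have hb2 : ∀ f g : ℝ → ℂ, Continuous f → HasCompactSupport f → Continuous g → HasCompactSupport g →
      Tendsto (fun s : ℝ => (∫ x : ℝ, SS f g (x - s) ∂μp) - (∫ x : ℝ, SS f g (x - s) ∂μm))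
        (cocompact ℝ) (𝓝 0) := by
    intro f g hf hc hg hd
    have H := fun c => hb _ (add_cont hf hg c) (add_cs hc hd c)
    have T := ((((H 1).const_mul (1/4)).add ((H (-1)).const_mul (-1/4))).add
      ((H Complex.I).const_mul (Complex.I/4))).add ((H (-Complex.I)).const_mul (-Complex.I/4))
    simp only [mul_zero, add_zero] at T
    refine T.congr fun s => ?_
    rw [mu_polar hf hc hg hd, mu_polar hf hc hg hd]
    ring
  obtain ⟨Cp, hp⟩ := htbp
  obtain ⟨Cm, hm⟩ := htbm
  obtain ⟨R, hR⟩ := hc.isCompact.isBounded.subset_closedBall 0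
  obtain ⟨n, hn⟩ := exists_nat_ge R
  have hs : ∀ x, (n:ℝ) < |x| → h x = 0 := by
    intro x hx
    by_contra h0
    have := hR (subset_tsupport _ h0)
    simp only [Metric.mem_closedBall, dist_zero_right, Real.norm_eq_abs] at this
    linarith
  rw [Metric.tendsto_nhds]
  intro ε hε
  set K : ℝ := (2 * (n+1 : ℕ) + 1) * Cp + (2 * (n+1 : ℕ) + 1) * Cm with hK
  have hK0 : 0 ≤ K := by positivity
  have hη : 0 < ε / 2 / (K + 1) := by positivity
  obtain ⟨v, hv, hvc, hvs, hva⟩ := approx hh hc hη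
  have hsupp : ∀ x, ((n+1 : ℕ):ℝ) < |x| → SS h v x - h x = 0 := by
    intro x hx
    push_cast at hx
    rw [SS_supp hs hvs x hx, hs x (by linarith), sub_zero]
  filter_upwards [(Metric.tendsto_nhds.1 (hb2 h v hh hc hv hvc)) (ε/2) (by positivity)] with s hss
  rw [dist_zero_right] at hss ⊢
  have b1 := conv_bound hp (n+1) hva hsupp s
  have b2 := conv_bound hm (n+1) hva hsupp s
  have i := SS_cont hh hc hv
  have i' := SS_cs hc hvc
  rw [integral_sub (ct_int i i' s) (ct_int hh hc s)] at b1 b2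
  have hlt : ε / 2 / (K + 1) * K ≤ ε / 2 := by
    rw [div_mul_eq_mul_div, div_le_iff₀ (by positivity)]
    nlinarith
  rw [hK, mul_add] at hlt
  set A := ∫ x, SS h v (x - s) ∂μp
  set B := ∫ x, SS h v (x - s) ∂μm
  set A' := ∫ x, h (x - s) ∂μp
  set B' := ∫ x, h (x - s) ∂μm
  have e : A' - B' = (A - B) - (A - A') + (B - B') := by ring
  rw [e]
  have t1 := norm_add_le ((A - B) - (A - A')) (B - B')
  have t2 := norm_sub_le (A - B) (A - A')
  linarith

/-- Connection between vanishing at infinity and Rajchman measures, on `ℝ`: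
let `μ = μ₊ - μ₋` be a translation bounded Fourier transformable measure whose
Fourier transform is `μ̂ = ν₁ - ν₂ + i(ν₃ - ν₄)`.  Then `μ` vanishes at
infinity iff for every `f ∈ C_c(ℝ)` the finite measure `|f̌|²·μ̂` is a
Rajchman measure, i.e. its Fourier--Stieltjes transform lies in `C₀(ℝ)`. -/
theorem vanishing_at_infinity_iff_rajchman
    (μp μm : Measure ℝ) [μp.Regular] [μm.Regular]
    (htbp : ∃ C : ℝ≥0, ∀ x : ℝ, μp (Set.Icc x (x + 1)) ≤ C)
    (htbm : ∃ C : ℝ≥0, ∀ x : ℝ, μm (Set.Icc x (x + 1)) ≤ C)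
    (ν₁ ν₂ ν₃ ν₄ : Measure ℝ) [ν₁.Regular] [ν₂.Regular] [ν₃.Regular] [ν₄.Regular]
    (hint : ∀ f : ℝ → ℂ, Continuous f → HasCompactSupport f →
      Integrable (fun ξ : ℝ =>
          ‖∫ x : ℝ, f x * Complex.exp (2 * π * Complex.I * ξ * x)‖ ^ 2) ν₁ ∧
      Integrable (fun ξ : ℝ =>
          ‖∫ x : ℝ, f x * Complex.exp (2 * π * Complex.I * ξ * x)‖ ^ 2) ν₂ ∧
      Integrable (fun ξ : ℝ =>
          ‖∫ x : ℝ, f x * Complex.exp (2 * π * Complex.I * ξ * x)‖ ^ 2) ν₃ ∧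
      Integrable (fun ξ : ℝ =>
          ‖∫ x : ℝ, f x * Complex.exp (2 * π * Complex.I * ξ * x)‖ ^ 2) ν₄)
    (hFT : ∀ f : ℝ → ℂ, Continuous f → HasCompactSupport f →
      (∫ x : ℝ, (∫ t : ℝ, f (x - t) * (starRingEnd ℂ) (f (-t))) ∂μp)
          - (∫ x : ℝ, (∫ t : ℝ, f (x - t) * (starRingEnd ℂ) (f (-t))) ∂μm)
        = ((∫ ξ : ℝ, Complex.ofReal
              (‖∫ x : ℝ, f x * Complex.exp (2 * π * Complex.I * ξ * x)‖ ^ 2) ∂ν₁)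
            - ∫ ξ : ℝ, Complex.ofReal
              (‖∫ x : ℝ, f x * Complex.exp (2 * π * Complex.I * ξ * x)‖ ^ 2) ∂ν₂)
          + Complex.I *
            ((∫ ξ : ℝ, Complex.ofReal
                (‖∫ x : ℝ, f x * Complex.exp (2 * π * Complex.I * ξ * x)‖ ^ 2) ∂ν₃)
              - ∫ ξ : ℝ, Complex.ofReal
                (‖∫ x : ℝ, f x * Complex.exp (2 * π * Complex.I * ξ * x)‖ ^ 2) ∂ν₄)) :
    (∀ g : ℝ → ℂ, Continuous g → HasCompactSupport g →
        Continuous (fun x : ℝ => (∫ t, g (x - t) ∂μp) - ∫ t, g (x - t) ∂μm) ∧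
          Tendsto (fun x : ℝ => (∫ t, g (x - t) ∂μp) - ∫ t, g (x - t) ∂μm)
            (cocompact ℝ) (𝓝 0)) ↔
      (∀ f : ℝ → ℂ, Continuous f → HasCompactSupport f →
        Continuous (fun t : ℝ =>
          ((∫ ξ : ℝ, Complex.ofReal
                (‖∫ x : ℝ, f x * Complex.exp (2 * π * Complex.I * ξ * x)‖ ^ 2)
              * Complex.exp (2 * π * Complex.I * t * ξ) ∂ν₁)
            - ∫ ξ : ℝ, Complex.ofReal
                (‖∫ x : ℝ, f x * Complex.exp (2 * π * Complex.I * ξ * x)‖ ^ 2)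
              * Complex.exp (2 * π * Complex.I * t * ξ) ∂ν₂)
          + Complex.I *
            ((∫ ξ : ℝ, Complex.ofReal
                  (‖∫ x : ℝ, f x * Complex.exp (2 * π * Complex.I * ξ * x)‖ ^ 2)
                * Complex.exp (2 * π * Complex.I * t * ξ) ∂ν₃)
              - ∫ ξ : ℝ, Complex.ofReal
                  (‖∫ x : ℝ, f x * Complex.exp (2 * π * Complex.I * ξ * x)‖ ^ 2)
                * Complex.exp (2 * π * Complex.I * t * ξ) ∂ν₄)) ∧
        Tendsto (fun t : ℝ =>
          ((∫ ξ : ℝ, Complex.ofReal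
                (‖∫ x : ℝ, f x * Complex.exp (2 * π * Complex.I * ξ * x)‖ ^ 2)
              * Complex.exp (2 * π * Complex.I * t * ξ) ∂ν₁)
            - ∫ ξ : ℝ, Complex.ofReal
                (‖∫ x : ℝ, f x * Complex.exp (2 * π * Complex.I * ξ * x)‖ ^ 2)
              * Complex.exp (2 * π * Complex.I * t * ξ) ∂ν₂)
          + Complex.I *
            ((∫ ξ : ℝ, Complex.ofReal
                  (‖∫ x : ℝ, f x * Complex.exp (2 * π * Complex.I * ξ * x)‖ ^ 2)
                * Complex.exp (2 * π * Complex.I * t * ξ) ∂ν₃)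
              - ∫ ξ : ℝ, Complex.ofReal
                  (‖∫ x : ℝ, f x * Complex.exp (2 * π * Complex.I * ξ * x)‖ ^ 2)
                * Complex.exp (2 * π * Complex.I * t * ξ) ∂ν₄))
          (cocompact ℝ) (𝓝 0)) := by
  have hint' : ∀ f : ℝ → ℂ, Continuous f → HasCompactSupport f →
      Integrable (fun ξ : ℝ => ‖EE f ξ‖ ^ 2) ν₁ ∧ Integrable (fun ξ : ℝ => ‖EE f ξ‖ ^ 2) ν₂ ∧
      Integrable (fun ξ : ℝ => ‖EE f ξ‖ ^ 2) ν₃ ∧ Integrable (fun ξ : ℝ => ‖EE f ξ‖ ^ 2) ν₄ := hint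
  have K := fun (f : ℝ → ℂ) (hf : Continuous f) (hc : HasCompactSupport f) (s : ℝ) =>
    key μp μm ν₁ ν₂ ν₃ ν₄ hint' hFT hf hc s
  constructor
  · intro ha f hf hc
    have h := ha (fun y => SS f f (-y)) ((SS_cont hf hc hf).comp continuous_neg)
      ((SS_cs hc hc).comp_homeomorph (Homeomorph.neg ℝ))
    simp only [neg_sub] at h
    exact ⟨h.1.congr (K f hf hc), h.2.congr (K f hf hc)⟩
  · intro hb g hg hc
    refine ⟨(ct_cont hg hc).sub (ct_cont hg hc), ?_⟩
    have h := dense_part μp μm htbp htbm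
      (fun f hf hc => (hb f hf hc).2.congr fun s => (K f hf hc s).symm)
      (h := fun y => g (-y)) (hg.comp continuous_neg) (hc.comp_homeomorph (Homeomorph.neg ℝ))
    simpa only [neg_sub] using h
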